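/- For Q(z) = |z|², 0 < r < √τ, and z₀ ∈ ℂ with |z₀| > √τ, the principal-value integral ∫_{𝔻(0;r)} u(z^{−1}) dB^{z₀}_{m,n}(z) tends to 0 as m → ∞ and n/m → τ, for every analytic polynomial u. -/

import Mathlib

open MeasureTheory Metric Complex Filter

noncomputable def dA : Measure ℂ := (ENNReal.ofReal Real.pi)⁻¹ • volume

noncomputable def EC (k : ℤ) (z : ℂ) : ℂ :=
  ∑ j ∈ Finset.range (k + 1).toNat, z ^ j / (Nat.factorial j)

noncomputable def ER (k : ℤ) (x : ℝ) : ℝ :=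
  ∑ j ∈ Finset.range (k + 1).toNat, x ^ j / (Nat.factorial j)

noncomputable def berBF (m : ℝ) (n : ℕ) (z₀ z : ℂ) : ℝ :=
  m * ‖EC ((n : ℤ) - 1) ((m : ℂ) * z * (starRingEnd ℂ) z₀)‖ ^ 2 /
    ER ((n : ℤ) - 1) (m * ‖z₀‖ ^ 2) * Real.exp (-(m * ‖z‖ ^ 2))

/-- principal value of an integral over a set `s`: `lim_{ε→0⁺} ∫_{s ∩ {|z|≥ε}} f dμ = L` -/
def PVIntegralOnEq (f : ℂ → ℂ) (s : Set ℂ) (μ : Measure ℂ) (L : ℂ) : Prop :=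
  Tendsto (fun ε : ℝ => ∫ z in s ∩ {w : ℂ | ε ≤ ‖w‖}, f z ∂μ)
    (nhdsWithin 0 (Set.Ioi 0)) (nhds L)

open scoped ComplexConjugate

instance : IsFiniteMeasureOnCompacts dA :=
  IsFiniteMeasureOnCompacts.smul _ (by simp [Real.pi_pos])

instance : NullSingletonClass dA where
  measure_singleton x := by simp [dA]

lemma integral_dA (f : ℂ → ℝ) : ∫ z, f z ∂dA = Real.pi⁻¹ * ∫ z, f z := by
  rw [dA, integral_smul_measure, ENNReal.toReal_inv, ENNReal.toReal_ofReal Real.pi_pos.le,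
    smul_eq_mul]

lemma measurePreserving_rotation_dA (c : Circle) : MeasurePreserving (rotation c) dA dA :=
  (rotation c).measurePreserving.smul_measure _

/-- Moments of the Gaussian weight against normalized area measure. -/
lemma integral_norm_pow_mul_exp_dA (b : ℕ) {t : ℝ} (ht : 0 < t) :
    ∫ z : ℂ, ‖z‖ ^ (2 * b) * Real.exp (-(t * ‖z‖ ^ 2)) ∂dA = b.factorial / t ^ (b + 1) := by
  have h := Complex.integral_rpow_mul_exp_neg_mul_rpow (p := 2) (q := (2 * b : ℕ)) (b := t)
    (by norm_num) (by have : (0 : ℝ) ≤ (2 * b : ℕ) := Nat.cast_nonneg _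
                      linarith) ht
  have e1 : (((2 * b : ℕ) : ℝ) + 2) / 2 = b + 1 := by push_cast; ring
  have e2 : -(((2 * b : ℕ) : ℝ) + 2) / 2 = -((b + 1 : ℕ) : ℝ) := by push_cast; ring
  rw [e1, e2, Real.Gamma_nat_eq_factorial, Real.rpow_neg ht.le, Real.rpow_natCast] at h
  simp only [Real.rpow_natCast, Real.rpow_two, neg_mul] at h
  rw [integral_dA, h]
  have := Real.pi_pos
  field_simp

lemma integrable_norm_pow_mul_exp_dA (b : ℕ) {t : ℝ} (ht : 0 < t) :
    Integrable (fun z : ℂ => ‖z‖ ^ (2 * b) * Real.exp (-(t * ‖z‖ ^ 2))) dA := by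
  by_contra h
  have h1 := integral_norm_pow_mul_exp_dA b ht
  rw [integral_undef h] at h1
  have : (0 : ℝ) < b.factorial / t ^ (b + 1) := by positivity
  linarith

/-- Chernoff bound for the Gaussian moments over a disc. -/
lemma setIntegral_ball_norm_pow_mul_exp_dA_le (b : ℕ) {t p : ℝ} (ht : 0 < t) (hp : 1 ≤ p)
    (r : ℝ) :
    ∫ z in ball (0 : ℂ) r, ‖z‖ ^ (2 * b) * Real.exp (-(t * ‖z‖ ^ 2)) ∂dA ≤
      Real.exp ((p - 1) * t * r ^ 2) * (b.factorial / (t * p) ^ (b + 1)) := by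
  have htp : 0 < t * p := by positivity
  rw [← integral_norm_pow_mul_exp_dA b htp, ← integral_const_mul]
  have hint := (integrable_norm_pow_mul_exp_dA b htp).const_mul (Real.exp ((p - 1) * t * r ^ 2))
  refine le_trans (setIntegral_mono_on (integrable_norm_pow_mul_exp_dA b ht).integrableOn
    hint.integrableOn measurableSet_ball fun z hz => ?_)
    (setIntegral_le_integral hint (Eventually.of_forall fun z => by positivity))
  rw [mul_left_comm, ← Real.exp_add]
  have hz' : ‖z‖ < r := by simpa using hz
  have : ‖z‖ ^ 2 ≤ r ^ 2 := by gcongr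
  gcongr
  nlinarith [mul_nonneg (mul_nonneg (sub_nonneg.2 hp) ht.le) (sub_nonneg.2 this)]

/-- Monomials of nonzero angular frequency integrate to zero over annuli. -/
lemma integral_annulus_monomial_eq_zero {ν a b : ℕ} (h : a ≠ b + ν) (t r ε : ℝ) :
    ∫ z in ball (0 : ℂ) r ∩ {w | ε ≤ ‖w‖},
      z⁻¹ ^ ν * (z ^ a * conj z ^ b) * (Real.exp (-(t * ‖z‖ ^ 2)) : ℂ) ∂dA = 0 := by
  set f : ℂ → ℂ := fun z => z⁻¹ ^ ν * (z ^ a * conj z ^ b) * (Real.exp (-(t * ‖z‖ ^ 2)) : ℂ)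
    with hf
  set d : ℤ := a - b - ν with hd
  have hd0 : (d : ℝ) ≠ 0 := by
    have : d ≠ 0 := by omega
    exact_mod_cast this
  set c : Circle := Circle.exp (Real.pi / d) with hc
  have hcd : (c : ℂ) ^ d = -1 := by
    rw [hc, Circle.coe_exp, ← Complex.exp_int_mul]
    have : (d : ℂ) ≠ 0 := by exact_mod_cast hd0
    rw [← Complex.exp_pi_mul_I]
    congr 1
    push_cast
    field_simp
  have hcc : conj (c : ℂ) = (c : ℂ)⁻¹ := by
    rw [← Circle.coe_inv_eq_conj, Circle.coe_inv]
  have hc0 : (c : ℂ) ≠ 0 := Circle.coe_ne_zero c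
  have hrot : ∀ z, f (rotation c z) = -f z := by
    intro z
    have hn : ‖(c : ℂ) * z‖ = ‖z‖ := by rw [norm_mul, Circle.norm_coe, one_mul]
    have hw : (c : ℂ)⁻¹ ^ ν * ((c : ℂ) ^ a * (c : ℂ)⁻¹ ^ b) = -1 := by
      rw [← hcd, hd, zpow_sub₀ hc0, zpow_sub₀ hc0]
      simp only [zpow_natCast, inv_pow]
      field_simp
    simp only [hf, rotation_apply, hn, map_mul, hcc, mul_inv, mul_pow]
    linear_combination (z⁻¹ ^ ν * (z ^ a * conj z ^ b) * (Real.exp (-(t * ‖z‖ ^ 2)) : ℂ)) * hw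
  have hpre : rotation c ⁻¹' (ball (0 : ℂ) r ∩ {w | ε ≤ ‖w‖}) =
      ball (0 : ℂ) r ∩ {w | ε ≤ ‖w‖} := by
    ext z
    simp only [Set.mem_preimage, Set.mem_inter_iff, mem_ball_zero_iff, Set.mem_ofPred_eq,
      LinearIsometryEquiv.norm_map]
  have key := (measurePreserving_rotation_dA c).setIntegral_preimage_emb
    (rotation c).toHomeomorph.measurableEmbedding f (ball (0 : ℂ) r ∩ {w | ε ≤ ‖w‖})
  rw [hpre] at key
  simp only [hrot, integral_neg] at key
  exact self_eq_neg.1 key.symm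

lemma measurableSet_annulus (ε : ℝ) : MeasurableSet {w : ℂ | ε ≤ ‖w‖} :=
  measurableSet_le measurable_const measurable_norm

lemma integrableOn_annulus_monomial (ν a b : ℕ) (t r : ℝ) {ε : ℝ} (hε : 0 < ε) :
    IntegrableOn (fun z : ℂ =>
      z⁻¹ ^ ν * (z ^ a * conj z ^ b) * (Real.exp (-(t * ‖z‖ ^ 2)) : ℂ))
      (ball (0 : ℂ) r ∩ {w | ε ≤ ‖w‖}) dA := by
  have hK : IsCompact (closedBall (0 : ℂ) r ∩ {w | ε ≤ ‖w‖}) :=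
    (isCompact_closedBall _ _).inter_right (isClosed_le continuous_const continuous_norm)
  refine IntegrableOn.mono_set (ContinuousOn.integrableOn_compact hK ?_)
    (Set.inter_subset_inter_left _ ball_subset_closedBall)
  have h0 : ContinuousOn (fun z : ℂ => z⁻¹) (closedBall (0 : ℂ) r ∩ {w | ε ≤ ‖w‖}) :=
    continuousOn_inv₀.mono fun z hz => norm_pos_iff.1 (hε.trans_le hz.2)
  have h1 : Continuous (fun z : ℂ => (z ^ a * conj z ^ b)) := by
    have := Complex.continuous_conj
    fun_prop
  have h2 : Continuous (fun z : ℂ => (Real.exp (-(t * ‖z‖ ^ 2)) : ℂ)) :=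
    Complex.continuous_ofReal.comp (by fun_prop)
  exact ((h0.pow ν).mul h1.continuousOn).mul h2.continuousOn

/-- The principal value of a monomial against a Gaussian weight. -/
lemma pvIntegralOnEq_monomial (ν a b : ℕ) {t : ℝ} (ht : 0 < t) (r : ℝ) :
    PVIntegralOnEq (fun z : ℂ =>
      z⁻¹ ^ ν * (z ^ a * conj z ^ b) * (Real.exp (-(t * ‖z‖ ^ 2)) : ℂ)) (ball 0 r) dA
      (if a = b + ν then
        ((∫ z in ball (0 : ℂ) r, ‖z‖ ^ (2 * b) * Real.exp (-(t * ‖z‖ ^ 2)) ∂dA : ℝ) : ℂ)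
        else 0) := by
  unfold PVIntegralOnEq
  split_ifs with h
  · subst h
    have hcov : AECover (dA.restrict (ball (0 : ℂ) r)) (nhdsWithin 0 (Set.Ioi 0))
        (fun ε : ℝ => {w : ℂ | ε ≤ ‖w‖}) := by
      refine ⟨?_, measurableSet_annulus⟩
      have : ∀ᵐ z ∂(dA.restrict (ball (0 : ℂ) r)), z ≠ 0 := by
        refine ae_restrict_of_ae ?_
        simp [ae_iff, measure_singleton]
      filter_upwards [this] with z hz
      exact nhdsWithin_le_nhds (Iic_mem_nhds (norm_pos_iff.2 hz))
    have hlim := hcov.integral_tendsto_of_countably_generated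
      (integrable_norm_pow_mul_exp_dA b ht).integrableOn
    refine ((Complex.continuous_ofReal.tendsto _).comp hlim).congr' ?_
    filter_upwards [self_mem_nhdsWithin] with ε hε
    rw [Function.comp_apply, Measure.restrict_restrict (measurableSet_annulus ε), Set.inter_comm,
      ← integral_complex_ofReal]
    refine setIntegral_congr_fun (measurableSet_ball.inter (measurableSet_annulus ε)) ?_
    intro z hz
    have hz0 : z ≠ 0 := norm_pos_iff.1 (lt_of_lt_of_le hε hz.2)
    have hzz : z * conj z = (‖z‖ : ℂ) ^ 2 := Complex.mul_conj' z
    have : z⁻¹ ^ ν * (z ^ (b + ν) * conj z ^ b) = (‖z‖ : ℂ) ^ (2 * b) := by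
      rw [pow_mul, ← hzz, mul_pow, pow_add, inv_pow]
      field_simp
    simp only [this]
    push_cast
    rfl
  · simp only [integral_annulus_monomial_eq_zero h]
    exact tendsto_const_nhds

lemma PVIntegralOnEq.sum_const_mul {ι : Type*} {s : Finset ι} {f : ι → ℂ → ℂ} {S : Set ℂ}
    {μ : Measure ℂ} {L : ι → ℂ} (c : ι → ℂ) (h : ∀ i ∈ s, PVIntegralOnEq (f i) S μ (L i))
    (hint : ∀ i ∈ s, ∀ ε : ℝ, 0 < ε → IntegrableOn (f i) (S ∩ {w | ε ≤ ‖w‖}) μ) :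
    PVIntegralOnEq (fun z => ∑ i ∈ s, c i * f i z) S μ (∑ i ∈ s, c i * L i) := by
  unfold PVIntegralOnEq
  refine (tendsto_finsetSum s fun i hi => (h i hi).const_mul (c i)).congr' ?_
  filter_upwards [self_mem_nhdsWithin] with ε hε
  rw [integral_finsetSum s fun i hi => (hint i hi ε hε).const_mul (c i)]
  simp only [integral_const_mul]

lemma EC_natCast_sub_one (n : ℕ) (z : ℂ) :
    EC ((n : ℤ) - 1) z = ∑ j ∈ Finset.range n, z ^ j / (Nat.factorial j) := by
  simp [EC]

lemma ER_natCast_sub_one (n : ℕ) (x : ℝ) :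
    ER ((n : ℤ) - 1) x = ∑ j ∈ Finset.range n, x ^ j / (Nat.factorial j) := by
  simp [ER]

/-- Coefficient of `z ^ a * conj z ^ b` in the polynomial factor of the Berezin density. -/
noncomputable def berCoeff (m : ℝ) (n : ℕ) (z₀ : ℂ) (a b : ℕ) : ℂ :=
  (m / ER ((n : ℤ) - 1) (m * ‖z₀‖ ^ 2) : ℝ) *
    ((m * conj z₀) ^ a / a.factorial * ((m * z₀) ^ b / b.factorial))

lemma berBF_eq_sum (m : ℝ) (n : ℕ) (z₀ z : ℂ) :
    (berBF m n z₀ z : ℂ) = ∑ x ∈ Finset.range n ×ˢ Finset.range n,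
      berCoeff m n z₀ x.1 x.2 * ((z ^ x.1 * conj z ^ x.2) * (Real.exp (-(m * ‖z‖ ^ 2)) : ℂ)) := by
  have h : ((‖EC ((n : ℤ) - 1) (m * z * conj z₀)‖ : ℝ) : ℂ) ^ 2 =
      ∑ x ∈ Finset.range n ×ˢ Finset.range n,
        ((m * conj z₀) ^ x.1 / x.1.factorial * ((m * z₀) ^ x.2 / x.2.factorial)) *
          (z ^ x.1 * conj z ^ x.2) := by
    rw [← Complex.mul_conj', EC_natCast_sub_one, map_sum, Finset.sum_mul_sum,
      Finset.sum_product]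
    refine Finset.sum_congr rfl fun a _ => Finset.sum_congr rfl fun b _ => ?_
    simp only [map_div₀, map_pow, map_mul, Complex.conj_conj, Complex.conj_ofReal, map_natCast]
    ring
  unfold berBF
  push_cast
  rw [h, mul_div_right_comm, Finset.mul_sum, Finset.sum_mul]
  refine Finset.sum_congr rfl fun x _ => ?_
  unfold berCoeff
  push_cast
  ring

/-- The principal value of `z ^ (-ν)` against the Berezin density over `𝔻(0; r)`. -/
noncomputable def berMoment (m : ℝ) (n : ℕ) (z₀ : ℂ) (r : ℝ) (ν : ℕ) : ℂ :=
  ∑ x ∈ Finset.range n ×ˢ Finset.range n, berCoeff m n z₀ x.1 x.2 *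
    (if x.1 = x.2 + ν then
      ((∫ z in ball (0 : ℂ) r, ‖z‖ ^ (2 * x.2) * Real.exp (-(m * ‖z‖ ^ 2)) ∂dA : ℝ) : ℂ)
      else 0)

lemma pvIntegralOnEq_eval_inv_mul_berBF {m : ℝ} (hm : 0 < m) (n : ℕ) (z₀ : ℂ) (r : ℝ)
    (u : Polynomial ℂ) :
    PVIntegralOnEq (fun z => u.eval z⁻¹ * (berBF m n z₀ z : ℂ)) (ball (0 : ℂ) r) dA
      (∑ ν ∈ Finset.range (u.natDegree + 1), u.coeff ν * berMoment m n z₀ r ν) := by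
  have h := PVIntegralOnEq.sum_const_mul
    (s := Finset.range (u.natDegree + 1) ×ˢ (Finset.range n ×ˢ Finset.range n))
    (fun i => u.coeff i.1 * berCoeff m n z₀ i.2.1 i.2.2)
    (fun i _ => pvIntegralOnEq_monomial i.1 i.2.1 i.2.2 hm r)
    (fun i _ ε hε => integrableOn_annulus_monomial i.1 i.2.1 i.2.2 m r hε)
  convert h using 1
  · funext z
    rw [Polynomial.eval_eq_sum_range, berBF_eq_sum, Finset.sum_mul_sum,
      Finset.sum_product (s := Finset.range (u.natDegree + 1))]
    refine Finset.sum_congr rfl fun ν _ => Finset.sum_congr rfl fun x _ => ?_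
    ring
  · rw [Finset.sum_product (s := Finset.range (u.natDegree + 1))]
    refine Finset.sum_congr rfl fun ν _ => ?_
    rw [berMoment, Finset.mul_sum]
    refine Finset.sum_congr rfl fun x _ => ?_
    ring

lemma pow_div_factorial_mul_pow_le {x q : ℝ} (hq : 0 < q) (j : ℕ) :
    ∀ i : ℕ, q * ((j + i : ℕ) : ℝ) ≤ x →
      x ^ j / j.factorial * q ^ i ≤ x ^ (j + i) / (j + i).factorial
  | 0, _ => by simp
  | i + 1, hx => by
    have hx0 : 0 ≤ x := le_trans (by positivity) hx
    have hx' : q * ((j + i : ℕ) : ℝ) ≤ x := by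
      refine le_trans ?_ hx
      gcongr
      omega
    have ih := pow_div_factorial_mul_pow_le hq j i hx'
    have hpos : (0 : ℝ) < (j + i + 1 : ℕ) := by positivity
    have hq' : q ≤ x / (j + i + 1 : ℕ) := (le_div_iff₀ hpos).2 hx
    calc x ^ j / j.factorial * q ^ (i + 1) = x ^ j / j.factorial * q ^ i * q := by ring
      _ ≤ x ^ (j + i) / (j + i).factorial * (x / (j + i + 1 : ℕ)) := by gcongr
      _ = x ^ (j + (i + 1)) / (j + (i + 1)).factorial := by
        rw [← add_assoc, Nat.factorial_succ, pow_succ]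
        push_cast
        have : ((j + i).factorial : ℝ) ≠ 0 := by positivity
        have : (j : ℝ) + i + 1 ≠ 0 := by positivity
        field_simp

lemma pow_div_factorial_mul_pow_le_ER {x q : ℝ} (hq : 0 < q) {n j i : ℕ} (hn : j + i < n)
    (hx : q * n ≤ x) : x ^ j / j.factorial * q ^ i ≤ ER ((n : ℤ) - 1) x := by
  have hx0 : 0 ≤ x := le_trans (by positivity) hx
  refine (pow_div_factorial_mul_pow_le hq j i ?_).trans ?_
  · refine le_trans ?_ hx
    gcongr
  · rw [ER_natCast_sub_one]
    exact Finset.single_le_sum (f := fun k => x ^ k / (k.factorial : ℝ))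
      (fun k _ => by positivity) (Finset.mem_range.2 hn)

lemma norm_berCoeff_mul_le {m : ℝ} (hm : 0 < m) {n : ℕ} {z₀ : ℂ} (hz₀ : 0 < ‖z₀‖) {p q : ℝ}
    (hp : 1 ≤ p) (hq : 0 < q) (hx : q * n ≤ m * ‖z₀‖ ^ 2) (r : ℝ) {ν b l : ℕ}
    (hn : b + ν + l + 1 = n) :
    ‖berCoeff m n z₀ (b + ν) b‖ *
        ∫ z in ball (0 : ℂ) r, ‖z‖ ^ (2 * b) * Real.exp (-(m * ‖z‖ ^ 2)) ∂dA ≤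
      (p / ‖z₀‖) ^ ν * (Real.exp ((p - 1) * m * r ^ 2) / p ^ n) * (p / q) ^ l := by
  have hw := pow_div_factorial_mul_pow_le_ER (j := b + ν) (i := l) hq (by omega) hx
  set E := ER ((n : ℤ) - 1) (m * ‖z₀‖ ^ 2) with hE
  have hp0 : 0 < p := by linarith
  have hE0 : 0 < E := lt_of_lt_of_le (by positivity) hw
  have hnorm : ‖berCoeff m n z₀ (b + ν) b‖ =
      m / E * ((m * ‖z₀‖) ^ (b + ν) / (b + ν).factorial * ((m * ‖z₀‖) ^ b / b.factorial)) := by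
    rw [berCoeff, ← hE]
    simp only [norm_mul, norm_div, norm_pow, Complex.norm_real, Complex.norm_natCast,
      RCLike.norm_conj, Real.norm_eq_abs, abs_of_pos hm, abs_of_pos hE0]
  rw [hnorm]
  calc _ ≤ m / E * ((m * ‖z₀‖) ^ (b + ν) / (b + ν).factorial * ((m * ‖z₀‖) ^ b / b.factorial)) *
        (Real.exp ((p - 1) * m * r ^ 2) * (b.factorial / (m * p) ^ (b + 1))) := by
        gcongr
        exact setIntegral_ball_norm_pow_mul_exp_dA_le b hm hp r
    _ = Real.exp ((p - 1) * m * r ^ 2) / p ^ (b + 1) / ‖z₀‖ ^ ν / q ^ l *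
        (((m * ‖z₀‖ ^ 2) ^ (b + ν) / (b + ν).factorial * q ^ l) / E) := by
        field_simp
        ring
    _ ≤ Real.exp ((p - 1) * m * r ^ 2) / p ^ (b + 1) / ‖z₀‖ ^ ν / q ^ l * 1 := by
        gcongr
        exact (div_le_one hE0).2 hw
    _ = _ := by
        rw [← hn, div_pow, div_pow]
        field_simp
        ring

lemma norm_berMoment_le {m : ℝ} (hm : 0 < m) {n : ℕ} {z₀ : ℂ} (hz₀ : 0 < ‖z₀‖) {p q : ℝ}
    (hp : 1 ≤ p) (hpq : p < q) (hx : q * n ≤ m * ‖z₀‖ ^ 2) (r : ℝ) (ν : ℕ) :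
    ‖berMoment m n z₀ r ν‖ ≤
      (p / ‖z₀‖) ^ ν * (Real.exp ((p - 1) * m * r ^ 2) / p ^ n) * (1 - p / q)⁻¹ := by
  have hp0 : 0 < p := by linarith
  have hq : 0 < q := by linarith
  set A := (p / ‖z₀‖) ^ ν * (Real.exp ((p - 1) * m * r ^ 2) / p ^ n) with hA
  have hA0 : 0 ≤ A := by positivity
  set G : ℕ → ℝ := fun b =>
    ∫ z in ball (0 : ℂ) r, ‖z‖ ^ (2 * b) * Real.exp (-(m * ‖z‖ ^ 2)) ∂dA with hG
  have hG0 : ∀ b, 0 ≤ G b := fun b => integral_nonneg fun z => by positivity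
  have hgeom : ∑ l ∈ Finset.range (n - ν), (p / q) ^ l ≤ (1 - p / q)⁻¹ := by
    have h1 : 0 < 1 - p / q := sub_pos.2 ((div_lt_one hq).2 hpq)
    rw [← one_div, le_div_iff₀' h1, mul_neg_geom_sum]
    exact sub_le_self _ (by positivity)
  have hsum : berMoment m n z₀ r ν =
      ∑ b ∈ Finset.range (n - ν), berCoeff m n z₀ (b + ν) b * (G b : ℂ) := by
    rw [berMoment, Finset.sum_product_right]
    simp only [mul_ite, mul_zero, Finset.sum_ite_eq', Finset.mem_range]
    rw [← Finset.sum_filter]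
    refine Finset.sum_congr ?_ fun b _ => rfl
    ext b
    simp only [Finset.mem_filter, Finset.mem_range]
    omega
  rw [hsum, ← Finset.sum_range_reflect]
  refine (norm_sum_le _ _).trans ?_
  calc _ ≤ ∑ l ∈ Finset.range (n - ν), A * (p / q) ^ l := by
        refine Finset.sum_le_sum fun l hl => ?_
        have hl' := Finset.mem_range.1 hl
        rw [norm_mul, Complex.norm_real, Real.norm_eq_abs, abs_of_nonneg (hG0 _)]
        exact norm_berCoeff_mul_le hm hz₀ hp hq hx r (by omega)
    _ ≤ A * (1 - p / q)⁻¹ := by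
        rw [← Finset.mul_sum]
        gcongr

lemma tendsto_exp_div_pow {m : ℕ → ℝ} {n : ℕ → ℕ} {τ r p : ℝ} (hp : 1 < p)
    (hpr : p * r ^ 2 < τ) (hm : Tendsto m atTop atTop)
    (hnm : Tendsto (fun k => (n k : ℝ) / m k) atTop (nhds τ)) :
    Tendsto (fun k => Real.exp ((p - 1) * m k * r ^ 2) / p ^ n k) atTop (nhds 0) := by
  have hp0 : 0 < p := by linarith
  have hτ : 0 < τ := lt_of_le_of_lt (by positivity) hpr
  have hneg : (p - 1) * r ^ 2 - τ * Real.log p < 0 := by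
    have h1 : 1 - p⁻¹ ≤ Real.log p := Real.one_sub_inv_le_log_of_pos hp0
    have h2 : (p - 1) * r ^ 2 < τ * (1 - p⁻¹) := by
      have : 1 - p⁻¹ = (p - 1) / p := by field_simp
      rw [this, mul_div_assoc', lt_div_iff₀ hp0]
      nlinarith
    nlinarith
  have hlim : Tendsto (fun k => m k * ((p - 1) * r ^ 2 - n k / m k * Real.log p)) atTop atBot :=
    hm.atTop_mul_neg hneg (tendsto_const_nhds.sub (hnm.mul_const _))
  refine (Real.tendsto_exp_atBot.comp hlim).congr' ?_
  filter_upwards [hm.eventually_gt_atTop 0] with k hk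
  rw [Function.comp_apply, ← Real.exp_log hp0, ← Real.exp_nat_mul, ← Real.exp_sub,
    Real.exp_log hp0]
  congr 1
  field_simp

lemma tendsto_berMoment {τ r : ℝ} {z₀ : ℂ} (hτ : 0 < τ) (hr : r ^ 2 < τ) (hz₀ : τ < ‖z₀‖ ^ 2)
    {m : ℕ → ℝ} {n : ℕ → ℕ} (hm : Tendsto m atTop atTop)
    (hnm : Tendsto (fun k => (n k : ℝ) / m k) atTop (nhds τ)) (ν : ℕ) :
    Tendsto (fun k => berMoment (m k) (n k) z₀ r ν) atTop (nhds 0) := by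
  have hz : 0 < ‖z₀‖ := by
    refine (norm_nonneg _).lt_of_ne fun h => ?_
    rw [← h] at hz₀
    norm_num at hz₀
    linarith
  obtain ⟨q, hq1, hq⟩ := exists_between ((one_lt_div hτ).2 hz₀)
  have hq0 : 0 < q := by linarith
  obtain ⟨p, hp1, hpq, hpr⟩ : ∃ p, 1 < p ∧ p < q ∧ p * r ^ 2 < τ := by
    have h1 : ∀ᶠ p in nhdsWithin (1 : ℝ) (Set.Ioi 1), p * r ^ 2 < τ :=
      nhdsWithin_le_nhds ((continuous_id.mul continuous_const).continuousAt.eventually_lt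
        continuousAt_const (by simpa using hr))
    have h2 : ∀ᶠ p in nhdsWithin (1 : ℝ) (Set.Ioi 1), p < q :=
      nhdsWithin_le_nhds (Iio_mem_nhds hq1)
    obtain ⟨p, hp⟩ := ((h1.and h2).and self_mem_nhdsWithin).exists
    exact ⟨p, hp.2, hp.1.2, hp.1.1⟩
  have hbound : Tendsto (fun k => (p / ‖z₀‖) ^ ν *
      (Real.exp ((p - 1) * m k * r ^ 2) / p ^ n k) * (1 - p / q)⁻¹) atTop (nhds 0) := by
    simpa using ((tendsto_exp_div_pow hp1 hpr hm hnm).const_mul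
      ((p / ‖z₀‖) ^ ν)).mul_const (1 - p / q)⁻¹
  refine squeeze_zero_norm' ?_ hbound
  have hlt : τ < ‖z₀‖ ^ 2 / q := by
    rw [lt_div_iff₀ hq0]
    rw [lt_div_iff₀ hτ] at hq
    linarith
  filter_upwards [hm.eventually_gt_atTop 0, hnm.eventually_lt_const hlt] with k hk hk'
  refine norm_berMoment_le hk hz hp1.le hpq ?_ r ν
  rw [div_lt_div_iff₀ hk hq0] at hk'
  linarith

/-- for `Q(z)=|z|²`, `0 < r < √τ` and `|z₀| > √τ`, the principal-value
integrals `p.v.∫_{𝔻(0;r)} u(z⁻¹) dB^{z₀}_{m,n}(z)` tend to `0` as `m → ∞`, `n/m → τ`,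
for every analytic polynomial `u`. -/
theorem bargmann_fock_bulk_pv_vanishes
    (τ : ℝ) (hτ : 0 < τ) (r : ℝ) (hr0 : 0 < r) (hr : r < Real.sqrt τ)
    (z₀ : ℂ) (hz₀ : Real.sqrt τ < ‖z₀‖)
    (u : Polynomial ℂ)
    (m : ℕ → ℝ) (n : ℕ → ℕ)
    (hm : Tendsto m atTop atTop) (hmpos : ∀ k, 0 < m k)
    (hnm : Tendsto (fun k => (n k : ℝ) / m k) atTop (nhds τ)) :
    ∃ I : ℕ → ℂ,
      (∀ k, PVIntegralOnEq (fun z => u.eval z⁻¹ * (berBF (m k) (n k) z₀ z : ℂ))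
        (ball (0:ℂ) r) dA (I k)) ∧
      Tendsto I atTop (nhds 0) := by
  have hr2 : r ^ 2 < τ := by rwa [Real.lt_sqrt hr0.le] at hr
  have hz2 : τ < ‖z₀‖ ^ 2 := (Real.sqrt_lt' (lt_of_le_of_lt (Real.sqrt_nonneg _) hz₀)).1 hz₀
  refine ⟨_, fun k => pvIntegralOnEq_eval_inv_mul_berBF (hmpos k) (n k) z₀ r u, ?_⟩
  simpa using tendsto_finsetSum (Finset.range (u.natDegree + 1)) fun ν _ =>
    (tendsto_berMoment hτ hr2 hz2 hm hnm ν).const_mul (u.coeff ν)
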